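/- arXiv:1001.5214 — 4 statements merged into one kernel-verified Lean document; each statement's English description precedes it below -/
import Mathlib

section
/- Let K be a quadratic field of discriminant d, and let p be an odd prime number not dividing d. Then: (i) if d is a nonzero quadratic residue modulo p (equivalently the Legendre symbol (d/p) = 1), then (p) is the product of two distinct prime ideals of 𝓞_K, each of absolute norm p; (ii) if d is a quadratic non-residue modulo p (Legendre symbol (d/p) = -1), then (p) is itself a prime ideal of 𝓞_K, of absolute norm p². -/
open Module

/-- The polarised Cayley-Hamilton identity in an algebra that is free of rank two. -/
theorem Algebra.two_mul_mul_eq_of_basis_fin_two {R A : Type*} [CommRing R] [CommRing A]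
    [Algebra R A] (b : Basis (Fin 2) R A) (x y : A) :
    2 * (x * y) = algebraMap R A (trace R A x) * y + algebraMap R A (trace R A y) * x
      - algebraMap R A (trace R A x * trace R A y) + algebraMap R A (trace R A (x * y)) := by
  apply leftMulMatrix_injective b
  have hxy : leftMulMatrix b x * leftMulMatrix b y = leftMulMatrix b y * leftMulMatrix b x := by
    rw [← map_mul, ← map_mul, mul_comm]
  rw [two_mul]
  simp only [map_add, map_sub, map_mul, AlgHom.commutes, trace_eq_matrix_trace b]
  nth_rewrite 2 [hxy]
  ext i j
  fin_cases i <;> fin_cases j <;>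
    simp [Matrix.mul_apply, Matrix.trace, Fin.sum_univ_two, Matrix.algebraMap_matrix_apply] <;>
    ring

/-- In an algebra that is free of rank two, the discriminant of a basis is, up to a factor two,
the square of an explicit element. -/
theorem Algebra.two_mul_sq_eq_two_mul_discr {R A : Type*} [CommRing R] [CommRing A]
    [Algebra R A] (b : Basis (Fin 2) R A) :
    2 * (trace R A (b 1) • b 0 - trace R A (b 0) • b 1) ^ 2
      = 2 * algebraMap R A (discr R b) := by
  have h1 : b.repr 1 0 • b 0 + b.repr 1 1 • b 1 = 1 := by
    rw [← Fin.sum_univ_two (fun i => b.repr 1 i • b i), b.sum_repr]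
  have key (z : A) : b.repr 1 0 * trace R A (z * b 0) + b.repr 1 1 * trace R A (z * b 1)
      = trace R A z := by
    conv_rhs => rw [← mul_one z, ← h1]
    simp [mul_add]
  have h00 := two_mul_mul_eq_of_basis_fin_two b (b 0) (b 0)
  have h01 := two_mul_mul_eq_of_basis_fin_two b (b 0) (b 1)
  have h11 := two_mul_mul_eq_of_basis_fin_two b (b 1) (b 1)
  have k0 := key (b 0)
  have k1 := key (b 1)
  have k2 : b.repr 1 0 * trace R A (b 0) + b.repr 1 1 * trace R A (b 1) = 2 := by
    have h := key 1
    rw [one_mul, one_mul, trace_eq_matrix_trace b 1,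
      map_one (leftMulMatrix b), Matrix.trace_one] at h
    simpa using h
  have hd : discr R b = trace R A (b 0 * b 0) * trace R A (b 1 * b 1)
      - trace R A (b 0 * b 1) ^ 2 := by
    simp only [discr_def, Matrix.det_fin_two, traceMatrix_apply, traceForm_apply]
    rw [mul_comm (b 1) (b 0)]
    ring
  rw [mul_comm (b 1) (b 0)] at k1
  rw [hd]
  generalize trace R A (b 0 * b 0) = s00 at *
  generalize trace R A (b 0 * b 1) = s01 at *
  generalize trace R A (b 1 * b 1) = s11 at *
  generalize trace R A (b 0) = t0 at *
  generalize trace R A (b 1) = t1 at *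
  generalize b.repr 1 0 = u at *
  generalize b.repr 1 1 = v at *
  have hs : t1 ^ 2 * s00 - 2 * t0 * t1 * s01 + t0 ^ 2 * s11 = 2 * (s00 * s11 - s01 ^ 2) := by
    subst k0 k1
    linear_combination (s00 * s11 - s01 ^ 2) * k2
  have hs' := congrArg (algebraMap R A) hs
  simp only [map_add, map_sub, map_mul, map_pow, map_ofNat, smul_def] at *
  linear_combination (algebraMap R A t1) ^ 2 * h00
    - 2 * algebraMap R A t0 * algebraMap R A t1 * h01 + (algebraMap R A t0) ^ 2 * h11 + hs'

namespace NumberField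

variable {K : Type*} [Field K] [NumberField K]

/-- The ring of integers of a quadratic field contains a trace zero square root of the
discriminant. -/
theorem exists_sq_eq_discr (hdeg : finrank ℚ K = 2) :
    ∃ δ : RingOfIntegers K, δ ^ 2 = (discr K : RingOfIntegers K) ∧
      Algebra.trace ℤ (RingOfIntegers K) δ = 0 := by
  have hr : finrank ℤ (RingOfIntegers K) = 2 := by rw [RingOfIntegers.rank, hdeg]
  let b : Basis (Fin 2) ℤ (RingOfIntegers K) := finBasisOfFinrankEq _ _ hr
  refine ⟨_, mul_left_cancel₀ two_ne_zero ((Algebra.two_mul_sq_eq_two_mul_discr b).trans ?_), ?_⟩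
  · rw [discr_eq_discr K b, eq_intCast]
  · rw [map_sub, map_smul, map_smul, smul_eq_mul, smul_eq_mul, mul_comm, sub_self]

theorem absNorm_span_natCast (hdeg : finrank ℚ K = 2) (n : ℕ) :
    Ideal.absNorm (Ideal.span {(n : RingOfIntegers K)}) = n ^ 2 := by
  have h : Algebra.norm ℤ (algebraMap ℤ (RingOfIntegers K) (n : ℤ)) = (n : ℤ) ^ 2 := by
    rw [Algebra.norm_algebraMap, RingOfIntegers.rank, hdeg]
  rw [Ideal.absNorm_span_singleton, ← Int.cast_natCast n, ← eq_intCast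
    (algebraMap ℤ (RingOfIntegers K)), h]
  simp [Int.natAbs_pow]

/-- Every algebraic integer is congruent to a rational integer modulo an ideal of prime norm. -/
theorem exists_intCast_sub_mem_of_absNorm_eq {p : ℕ} [Fact p.Prime]
    {P : Ideal (RingOfIntegers K)} (hP : Ideal.absNorm P = p) (x : RingOfIntegers K) :
    ∃ a : ℤ, x - a ∈ P := by
  have hc : Nat.card (RingOfIntegers K ⧸ P) = p := by
    rw [← hP, Ideal.absNorm_apply, Submodule.cardQuot_apply]
  have : Finite (RingOfIntegers K ⧸ P) :=
    Nat.finite_of_card_ne_zero (hc ▸ (Fact.out : p.Prime).ne_zero)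
  have := Fintype.ofFinite (RingOfIntegers K ⧸ P)
  rw [Nat.card_eq_fintype_card] at hc
  obtain ⟨a, ha⟩ := (ZMod.ringEquivOfPrime _ (Fact.out : p.Prime) hc).surjective
    (Ideal.Quotient.mk P x)
  obtain ⟨a, rfl⟩ := ZMod.intCast_surjective a
  refine ⟨a, Ideal.Quotient.eq.mp ?_⟩
  rw [← ha, map_intCast, map_intCast]

theorem intCast_dvd_of_mem {p : ℕ} [hp : Fact p.Prime]
    {P : Ideal (RingOfIntegers K)} (hP : P ≠ ⊤) (hpP : (p : RingOfIntegers K) ∈ P) {a : ℤ}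
    (ha : (a : RingOfIntegers K) ∈ P) : (p : ℤ) ∣ a := by
  by_contra h
  obtain ⟨u, v, huv⟩ := ((Nat.prime_iff_prime_int.mp hp.out).coprime_iff_not_dvd).mpr h
  refine hP ((Ideal.eq_top_iff_one P).mpr ?_)
  have h1 : (u : RingOfIntegers K) * p + v * a = 1 := by exact_mod_cast huv
  exact h1 ▸ P.add_mem (P.mul_mem_left _ hpP) (P.mul_mem_left _ ha)

theorem isPrime_span_of_not_isSquare_discr (hdeg : finrank ℚ K = 2) {p : ℕ} [hp : Fact p.Prime]
    (hd : ¬ IsSquare (discr K : ZMod p)) :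
    (Ideal.span {(p : RingOfIntegers K)}).IsPrime := by
  obtain ⟨δ, hδ, -⟩ := exists_sq_eq_discr hdeg
  have hN := absNorm_span_natCast hdeg p
  have hne : Ideal.span {(p : RingOfIntegers K)} ≠ ⊤ := by
    intro h
    rw [h, Ideal.absNorm_top] at hN
    exact (Nat.one_lt_pow two_ne_zero hp.out.one_lt).ne hN
  obtain ⟨P, hPmax, hle⟩ := Ideal.exists_le_maximal _ hne
  have hpP : (p : RingOfIntegers K) ∈ P := hle (Ideal.mem_span_singleton_self _)
  have hdvd : Ideal.absNorm P ∣ p ^ 2 := hN ▸ Ideal.absNorm_dvd_absNorm_of_le hle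
  obtain ⟨k, hk, hPk⟩ := (Nat.dvd_prime_pow hp.out).mp hdvd
  interval_cases k
  · exact absurd (Ideal.absNorm_eq_one_iff.mp (by simpa using hPk)) hPmax.ne_top
  · obtain ⟨a, ha⟩ := exists_intCast_sub_mem_of_absNorm_eq (by simpa using hPk) δ
    have hmem : ((discr K - a ^ 2 : ℤ) : RingOfIntegers K) ∈ P := by
      have : ((discr K - a ^ 2 : ℤ) : RingOfIntegers K) = (δ + a) * (δ - a) := by
        push_cast
        rw [← hδ]
        ring
      exact this ▸ P.mul_mem_left _ ha
    have h := (ZMod.intCast_zmod_eq_zero_iff_dvd _ _).mpr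
      (intCast_dvd_of_mem hPmax.ne_top hpP hmem)
    push_cast at h
    exact absurd ⟨(a : ZMod p), by rw [← sq]; exact sub_eq_zero.mp h⟩ hd
  · obtain ⟨J, hJ⟩ := Ideal.dvd_iff_le.mpr hle
    have hJ1 : Ideal.absNorm J = 1 := by
      have h := congrArg Ideal.absNorm hJ
      rw [map_mul, hN, hPk] at h
      exact Nat.eq_of_mul_eq_mul_left (pow_pos hp.out.pos 2) (by rw [← h, mul_one])
    rw [hJ, Ideal.absNorm_eq_one_iff.mp hJ1, Ideal.mul_top]
    exact hPmax.isPrime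

theorem exists_span_eq_mul_of_sq_eq_discr (hdeg : finrank ℚ K = 2) {p : ℕ} [hp : Fact p.Prime]
    (hodd : p ≠ 2) {a : ℤ} (hpa : ¬ (p : ℤ) ∣ a) (had : (p : ℤ) ∣ discr K - a ^ 2) :
    ∃ P P' : Ideal (RingOfIntegers K), P.IsPrime ∧ P'.IsPrime ∧ P ≠ P' ∧
      Ideal.span {(p : RingOfIntegers K)} = P * P' ∧
      Ideal.absNorm P = p ∧ Ideal.absNorm P' = p := by
  obtain ⟨δ, hδ, htr⟩ := exists_sq_eq_discr hdeg
  have hpp := Nat.prime_iff_prime_int.mp hp.out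
  have hN := absNorm_span_natCast hdeg p
  have h2a : ¬ (p : ℤ) ∣ 2 * a := fun h => (hpp.dvd_or_dvd h).elim
    (fun h => hodd ((Nat.prime_dvd_prime_iff_eq hp.out Nat.prime_two).mp (by exact_mod_cast h)))
    hpa
  have hnot (c : ℤ) (hc : ¬ (p : ℤ) ∣ 2 * c) :
      δ + c ∉ Ideal.span {(p : RingOfIntegers K)} := by
    intro h
    obtain ⟨z, hz⟩ := Ideal.mem_span_singleton'.mp h
    apply hc
    have hc' : Algebra.trace ℤ (RingOfIntegers K) (c : RingOfIntegers K) = 2 * c := by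
      rw [← eq_intCast (algebraMap ℤ (RingOfIntegers K)), Algebra.trace_algebraMap,
        RingOfIntegers.rank, hdeg, nsmul_eq_mul, Nat.cast_ofNat]
    have hz' := congrArg (Algebra.trace ℤ (RingOfIntegers K)) hz
    rw [map_add, htr, zero_add, hc', mul_comm z, ← nsmul_eq_mul, map_nsmul, nsmul_eq_mul] at hz'
    exact ⟨_, hz'.symm⟩
  obtain ⟨m, hm⟩ := had
  obtain ⟨u, v, huv⟩ := (hpp.coprime_iff_not_dvd).mpr h2a
  have hm' : (δ + a) * (δ + (-a : ℤ)) = (p : RingOfIntegers K) * m := by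
    have : (discr K : RingOfIntegers K) - a ^ 2 = p * m := by exact_mod_cast hm
    rw [← this, ← hδ]
    push_cast
    ring
  have huv' : (u : RingOfIntegers K) * p + v * (2 * a) = 1 := by exact_mod_cast huv
  let Q (c : ℤ) : Ideal (RingOfIntegers K) := Ideal.span {(p : RingOfIntegers K), δ + c}
  have hp_mem (c : ℤ) : (p : RingOfIntegers K) ∈ Q c := Ideal.subset_span (by simp)
  have hδ_mem (c : ℤ) : δ + c ∈ Q c := Ideal.subset_span (by simp)
  have hmul : Ideal.span {(p : RingOfIntegers K)} = Q a * Q (-a) := by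
    apply le_antisymm
    · rw [Ideal.span_singleton_le_iff_mem]
      have h : (p : RingOfIntegers K) = u * (p * p) +
          (v * ((δ + a) * p) - v * (p * (δ + (-a : ℤ)))) := by
        push_cast
        linear_combination -(p : RingOfIntegers K) * huv'
      rw [h]
      exact add_mem (Ideal.mul_mem_left _ _ (Ideal.mul_mem_mul (hp_mem _) (hp_mem _)))
        (sub_mem (Ideal.mul_mem_left _ _ (Ideal.mul_mem_mul (hδ_mem _) (hp_mem _)))
          (Ideal.mul_mem_left _ _ (Ideal.mul_mem_mul (hp_mem _) (hδ_mem _))))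
    · rw [Ideal.span_pair_mul_span_pair, Ideal.span_le]
      rintro x (rfl | rfl | rfl | rfl) <;>
        rw [SetLike.mem_coe, Ideal.mem_span_singleton]
      · exact dvd_mul_right _ _
      · exact dvd_mul_right _ _
      · exact dvd_mul_left _ _
      · exact hm' ▸ dvd_mul_right _ _
  have hNmul : Ideal.absNorm (Q a) * Ideal.absNorm (Q (-a)) = p ^ 2 := by
    rw [← map_mul, ← hmul, hN]
  have hQa : Ideal.absNorm (Q a) ≠ 1 := fun h => by
    rw [Ideal.absNorm_eq_one_iff] at h
    rw [h, Ideal.top_mul] at hmul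
    exact hnot (-a) (by rwa [mul_neg, dvd_neg]) (hmul ▸ hδ_mem (-a))
  have hQa' : Ideal.absNorm (Q (-a)) ≠ 1 := fun h => by
    rw [Ideal.absNorm_eq_one_iff] at h
    rw [h, Ideal.mul_top] at hmul
    exact hnot a h2a (hmul ▸ hδ_mem a)
  obtain ⟨hn, hn'⟩ := (hp.out.mul_eq_prime_sq_iff hQa hQa').mp hNmul
  refine ⟨Q a, Q (-a), Ideal.isPrime_of_irreducible_absNorm (hn ▸ hp.out),
    Ideal.isPrime_of_irreducible_absNorm (hn' ▸ hp.out), fun h => ?_, hmul, hn, hn'⟩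
  refine h2a (intCast_dvd_of_mem (fun h => hQa (Ideal.absNorm_eq_one_iff.mpr h)) (hp_mem a) ?_)
  have h2 : ((2 * a : ℤ) : RingOfIntegers K) = (δ + a) - (δ + (-a : ℤ)) := by
    push_cast
    ring
  exact h2 ▸ sub_mem (hδ_mem a) (h ▸ hδ_mem (-a))

end NumberField


/-- Splitting of an odd prime `p` not dividing the discriminant `d` of a quadratic
field, according to the Legendre symbol `(d/p)`: if `(d/p) = 1` then `(p)` splits
as a product of two distinct prime ideals of norm `p`; if `(d/p) = -1` then `(p)`
is inert, i.e. itself a prime ideal of norm `p²`. -/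
theorem splitting_of_odd_prime_not_dvd_discr
    (K : Type*) [Field K] [NumberField K]
    (hdeg : Module.finrank ℚ K = 2)
    (p : ℕ) [hp : Fact p.Prime] (hodd : p ≠ 2)
    (hndvd : ¬ (p : ℤ) ∣ NumberField.discr K) :
    (legendreSym p (NumberField.discr K) = 1 →
      ∃ P P' : Ideal (NumberField.RingOfIntegers K), P.IsPrime ∧ P'.IsPrime ∧ P ≠ P' ∧
        Ideal.span {(p : NumberField.RingOfIntegers K)} = P * P' ∧
        Ideal.absNorm P = p ∧ Ideal.absNorm P' = p) ∧
    (legendreSym p (NumberField.discr K) = -1 →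
      (Ideal.span {(p : NumberField.RingOfIntegers K)}).IsPrime ∧
        Ideal.absNorm (Ideal.span {(p : NumberField.RingOfIntegers K)}) = p ^ 2) := by
  refine ⟨fun h => ?_, fun h => ⟨NumberField.isPrime_span_of_not_isSquare_discr hdeg
    ((legendreSym.eq_neg_one_iff p).mp h), NumberField.absNorm_span_natCast hdeg p⟩⟩
  have hd0 : (NumberField.discr K : ZMod p) ≠ 0 := fun h0 =>
    hndvd ((ZMod.intCast_zmod_eq_zero_iff_dvd _ _).mp h0)
  obtain ⟨a, ha⟩ := (legendreSym.eq_one_iff p hd0).mp h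
  obtain ⟨a, rfl⟩ := ZMod.intCast_surjective a
  refine NumberField.exists_span_eq_mul_of_sq_eq_discr hdeg hodd (a := a) (fun hpa => hd0 ?_) ?_
  · rw [ha, (ZMod.intCast_zmod_eq_zero_iff_dvd _ _).mpr hpa, mul_zero]
  · rw [← ZMod.intCast_zmod_eq_zero_iff_dvd]
    push_cast
    rw [ha]
    ring
end

section
/- (Behrbohm–Rédei criterion) Let r be a positive square-free integer with r > 1 and K = ℚ(√r). If the ring of integers of K is a unique factorization domain (equivalently, K has class number 1), then either r is a prime number, or r = p·q where p and q are prime numbers with p ≡ 3 (mod 4) and either q = 2 or q ≡ 3 (mod 4). -/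
/-- In a principal ideal domain, a factor of a square that is coprime to its cofactor is a unit
times a square. -/
theorem IsCoprime.exists_unit_mul_sq {R : Type*} [CommRing R] [IsDomain R]
    [IsPrincipalIdealRing R] {a b c : R} (hab : IsCoprime a b) (h : a * b = c ^ 2) :
    ∃ (u : Rˣ) (d : R), a = u * d ^ 2 := by
  obtain ⟨d, u, hu⟩ := exists_associated_pow_of_mul_eq_pow' hab h
  exact ⟨u, d, by rw [← hu, mul_comm]⟩

theorem Nat.eq_of_squarefree_of_isSquare_mul {a b : ℕ} (ha : Squarefree a) (hb : Squarefree b)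
    (h : IsSquare (a * b)) : a = b := by
  obtain ⟨c, hc⟩ := h
  rw [← sq] at hc
  have key : ∀ {x y : ℕ}, Squarefree x → x * y = c ^ 2 → x ∣ y := by
    intro x y hx hxy
    obtain ⟨d, rfl⟩ := (hx.dvd_pow_iff_dvd two_ne_zero).1 (Dvd.intro _ hxy)
    exact ⟨d ^ 2, Nat.eq_of_mul_eq_mul_left (Nat.pos_of_ne_zero hx.ne_zero)
      (by rw [hxy]; ring)⟩
  exact Nat.dvd_antisymm (key ha hc) (key hb (by rw [mul_comm, hc]))

namespace RealQuadratic

open NumberField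

variable {K : Type*} [Field K] [NumberField K] {r : ℕ} {α : K}

theorem exists_eq_add_mul (hr : Squarefree r) (h1 : 1 < r) (hdeg : Module.finrank ℚ K = 2)
    (hα : α ^ 2 = (r : K)) (x : K) : ∃ a b : ℚ, x = a + b * α := by
  have hrat : ∀ q : ℚ, (q : K) ≠ α := by
    rintro q rfl
    have hq : IsSquare (r : ℚ) := ⟨q, by rw [← sq]; exact_mod_cast hα.symm⟩
    rw [Rat.isSquare_natCast_iff] at hq
    have := Nat.eq_of_squarefree_of_isSquare_mul hr squarefree_one (by simpa using hq)
    omega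
  have hli : LinearIndependent ℚ ![(1 : K), α] := by
    rw [LinearIndependent.pair_iff]
    intro s t hst
    rw [Algebra.smul_def, Algebra.smul_def, mul_one, eq_ratCast, eq_ratCast] at hst
    have ht : t = 0 := by
      by_contra ht
      refine hrat (-s / t) ?_
      have : (t : K) ≠ 0 := by exact_mod_cast ht
      push_cast
      field_simp
      linear_combination -hst
    subst ht
    simpa using hst
  have hspan := hli.span_eq_top_of_card_eq_finrank' (by simp [hdeg])
  have hx : x ∈ Submodule.span ℚ (Set.range ![(1 : K), α]) := hspan ▸ Submodule.mem_top
  rw [Matrix.range_cons, Matrix.range_cons, Matrix.range_empty, Set.union_empty,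
    Set.singleton_union, Submodule.mem_span_pair] at hx
  obtain ⟨a, b, rfl⟩ := hx
  exact ⟨a, b, by simp [Algebra.smul_def]⟩

theorem isReal_embedding (hr : Squarefree r) (h1 : 1 < r) (hdeg : Module.finrank ℚ K = 2)
    (hα : α ^ 2 = (r : K)) (φ : K →+* ℂ) : ComplexEmbedding.IsReal φ := by
  have h : φ α ^ 2 = ((√(r : ℝ) : ℝ) : ℂ) ^ 2 := by
    rw [← map_pow, hα, map_natCast, ← Complex.ofReal_pow, Real.sq_sqrt (by positivity)]
    simp
  ext x
  obtain ⟨a, b, rfl⟩ := exists_eq_add_mul hr h1 hdeg hα x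
  rcases sq_eq_sq_iff_eq_or_eq_neg.1 h with h | h <;>
    simp [ComplexEmbedding.conjugate_coe_eq, h, -Complex.ofReal_neg]

theorem exists_real_embeddings (hr : Squarefree r) (h1 : 1 < r)
    (hdeg : Module.finrank ℚ K = 2) (hα : α ^ 2 = (r : K)) :
    ∃ f g : K →+* ℝ, g α = -f α := by
  have hcard : 1 < Fintype.card (K →+* ℂ) := by
    rw [Embeddings.card, hdeg]
    exact one_lt_two
  obtain ⟨φ, ψ, hne⟩ := Fintype.one_lt_card_iff.1 hcard
  have hφ := isReal_embedding hr h1 hdeg hα φ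
  have hψ := isReal_embedding hr h1 hdeg hα ψ
  refine ⟨hφ.embedding, hψ.embedding, ?_⟩
  have h : ψ α ^ 2 = φ α ^ 2 := by simp [← map_pow, hα]
  rcases sq_eq_sq_iff_eq_or_eq_neg.1 h with h | h
  · refine absurd (RingHom.ext fun x ↦ ?_) hne
    obtain ⟨a, b, rfl⟩ := exists_eq_add_mul hr h1 hdeg hα x
    simp [h]
  · apply Complex.ofReal_injective
    push_cast
    rw [hφ.coe_embedding_apply, hψ.coe_embedding_apply, h]

theorem eq_one_or_eq_of_isSquare (hr : Squarefree r) (h1 : 1 < r)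
    (hdeg : Module.finrank ℚ K = 2) (hα : α ^ 2 = (r : K)) {d : ℕ} (hd : Squarefree d)
    (h : IsSquare (d : K)) : d = 1 ∨ d = r := by
  obtain ⟨x, hx⟩ := h
  obtain ⟨f, g, hfg⟩ := exists_real_embeddings hr h1 hdeg hα
  obtain ⟨a, b, rfl⟩ := exists_eq_add_mul hr h1 hdeg hα x
  have hf : (d : ℝ) = (a + b * f α) * (a + b * f α) := by simpa using congrArg f hx
  have hg : (d : ℝ) = (a + b * -f α) * (a + b * -f α) := by simpa [hfg] using congrArg g hx
  have hfα : f α ^ 2 = r := by simp [← map_pow, hα]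
  have hα0 : f α ≠ 0 := by
    intro h0
    rw [h0] at hfα
    have : (r : ℝ) = 0 := by simpa using hfα.symm
    have : r = 0 := by exact_mod_cast this
    omega
  have hab : (a : ℝ) * b = 0 := by
    have : (a : ℝ) * b * f α = 0 := by linear_combination (hg - hf) / 4
    exact (mul_eq_zero.1 this).resolve_right hα0
  rcases mul_eq_zero.1 hab with ha | hb
  · right
    apply Nat.eq_of_squarefree_of_isSquare_mul hd hr
    rw [← Rat.isSquare_natCast_iff]
    refine ⟨b * r, ?_⟩
    have : ((d * r : ℕ) : ℝ) = b * r * (b * r) := by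
      rw [ha] at hf
      push_cast
      linear_combination (r : ℝ) * hf + (r : ℝ) * b ^ 2 * hfα
    exact_mod_cast this
  · left
    apply Nat.eq_of_squarefree_of_isSquare_mul hd squarefree_one
    rw [mul_one, ← Rat.isSquare_natCast_iff]
    refine ⟨a, ?_⟩
    have : (d : ℝ) = a * a := by
      rw [hb] at hf
      linear_combination hf
    exact_mod_cast this

theorem exists_unit_generating_mod_squares (hr : Squarefree r) (h1 : 1 < r)
    (hdeg : Module.finrank ℚ K = 2) (hα : α ^ 2 = (r : K)) :
    ∃ η : (𝓞 K)ˣ, ∀ u : (𝓞 K)ˣ, ∃ w : (𝓞 K)ˣ,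
      u = w ^ 2 ∨ u = -w ^ 2 ∨ u = η * w ^ 2 ∨ u = -(η * w ^ 2) := by
  obtain ⟨f, -, -⟩ := exists_real_embeddings hr h1 hdeg hα
  have : IsTotallyReal K := ⟨fun v ↦ by
    rw [← InfinitePlace.mk_embedding v, InfinitePlace.isReal_mk_iff]
    exact isReal_embedding hr h1 hdeg hα _⟩
  have hrank : Units.rank K = 1 := by
    rw [Units.rank, InfinitePlace.card_eq_nrRealPlaces_add_nrComplexPlaces,
      IsTotallyReal.nrComplexPlaces_eq_zero, ← IsTotallyReal.finrank, hdeg]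
  let e : Fin (Units.rank K) ≃ Fin 1 := finCongr hrank
  have : Unique (Fin (Units.rank K)) := e.unique
  have htors : ∀ ζ ∈ Units.torsion K, ζ = 1 ∨ ζ = -1 := by
    intro ζ hζ
    obtain ⟨n, hn, hζn⟩ := isOfFinOrder_iff_pow_eq_one.1 ((CommGroup.mem_torsion _).1 hζ)
    have habs : |f (ζ : 𝓞 K)| = 1 := by
      have : f (ζ : 𝓞 K) ^ n = 1 := by
        rw [← map_pow]
        simpa using congrArg (fun u : (𝓞 K)ˣ ↦ f ((u : 𝓞 K) : K)) hζn
      exact (pow_eq_one_iff_of_nonneg (abs_nonneg _) hn.ne').1 (by rw [← abs_pow, this, abs_one])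
    have hinj : ∀ x y : (𝓞 K)ˣ, f (x : 𝓞 K) = f (y : 𝓞 K) → x = y := fun x y h ↦
      Units.ext (RingOfIntegers.ext (f.injective h))
    rcases eq_or_eq_neg_of_abs_eq habs with h | h
    · exact Or.inl (hinj _ _ (by simpa using h))
    · exact Or.inr (hinj _ _ (by simpa using h))
  refine ⟨Units.fundSystem K default, fun u ↦ ?_⟩
  obtain ⟨⟨ζ, n⟩, hu, -⟩ := Units.exist_unique_eq_mul_prod K u
  simp only [Fintype.prod_unique] at hu
  rcases Int.even_or_odd' (n default) with ⟨k, hk | hk⟩ <;>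
    refine ⟨Units.fundSystem K default ^ k, ?_⟩ <;>
    rcases htors ζ ζ.2 with h | h <;>
    rw [hu, h, hk]
  · left
    rw [one_mul, ← zpow_natCast, ← zpow_mul, mul_comm]; rfl
  · right; left
    rw [neg_one_mul, ← zpow_natCast, ← zpow_mul, mul_comm]; rfl
  · right; right; left
    rw [one_mul, ← zpow_natCast, ← zpow_mul, zpow_add_one, mul_comm, mul_comm k]; rfl
  · right; right; right
    rw [neg_one_mul, ← zpow_natCast, ← zpow_mul, zpow_add_one, mul_comm, mul_comm k]; rfl

theorem isSquare_or_isSquare_or_isSquare_mul (hr : Squarefree r) (h1 : 1 < r)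
    (hdeg : Module.finrank ℚ K = 2) (hα : α ^ 2 = (r : K)) (f : K →+* ℝ) {u v : (𝓞 K)ˣ}
    (hu : 0 < f (u : 𝓞 K)) (hv : 0 < f (v : 𝓞 K)) :
    IsSquare u ∨ IsSquare v ∨ IsSquare (u * v) := by
  obtain ⟨η, hη⟩ := exists_unit_generating_mod_squares hr h1 hdeg hα
  obtain ⟨w, hw⟩ := hη u
  obtain ⟨z, hz⟩ := hη v
  have hneg : ∀ t s : (𝓞 K)ˣ, t = -s ^ 2 → ¬ 0 < f (t : 𝓞 K) := by
    rintro t s rfl h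
    simp only [Units.val_neg, Units.val_pow_eq_pow_val, map_neg, map_pow] at h
    nlinarith [sq_nonneg (f (s : 𝓞 K))]
  have huv : 0 < f ((u * v : (𝓞 K)ˣ) : 𝓞 K) := by
    simpa using mul_pos hu hv
  rcases hw with hw | hw | hw | hw
  · exact Or.inl ⟨w, by rw [hw, sq]⟩
  · exact absurd hu (hneg u w hw)
  all_goals
    rcases hz with hz | hz | hz | hz
    · exact Or.inr (Or.inl ⟨z, by rw [hz, sq]⟩)
    · exact absurd hv (hneg v z hz)
  · exact Or.inr (Or.inr ⟨η * w * z, by rw [hw, hz]; simp only [sq]; ac_rfl⟩)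
  · refine absurd huv (hneg _ (η * w * z) ?_)
    rw [hw, hz, mul_neg]; simp only [sq]; congr 1; ac_rfl
  · refine absurd huv (hneg _ (η * w * z) ?_)
    rw [hw, hz, neg_mul]; simp only [sq]; congr 1; ac_rfl
  · exact Or.inr (Or.inr ⟨η * w * z, by rw [hw, hz, neg_mul_neg]; simp only [sq]; ac_rfl⟩)

theorem isSquare_of_mul_neg (hr : Squarefree r) (h1 : 1 < r) (hdeg : Module.finrank ℚ K = 2)
    (hα : α ^ 2 = (r : K)) (f g : K →+* ℝ) {u v : (𝓞 K)ˣ}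
    (hv : f (v : 𝓞 K) * g (v : 𝓞 K) < 0) (hfu : 0 < f (u : 𝓞 K)) (hgu : 0 < g (u : 𝓞 K)) :
    IsSquare u := by
  obtain ⟨η, hη⟩ := exists_unit_generating_mod_squares hr h1 hdeg hα
  have hηneg : f (η : 𝓞 K) * g (η : 𝓞 K) < 0 := by
    obtain ⟨z, hz⟩ := hη v
    rcases hz with rfl | rfl | rfl | rfl <;>
      simp only [Units.val_neg, Units.val_mul, Units.val_pow_eq_pow_val, map_neg, map_mul,
        map_pow] at hv <;>
      nlinarith [sq_nonneg (f (z : 𝓞 K) * g (z : 𝓞 K))]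
  have hpos := mul_pos hfu hgu
  obtain ⟨w, hw⟩ := hη u
  rcases hw with rfl | rfl | rfl | rfl
  · exact ⟨w, sq w⟩
  all_goals
    simp only [Units.val_neg, Units.val_mul, Units.val_pow_eq_pow_val, map_neg, map_mul,
      map_pow] at hfu hpos
    nlinarith [sq_nonneg (f (w : 𝓞 K) * g (w : 𝓞 K)), sq_nonneg (f (w : 𝓞 K))]

omit [NumberField K] in
theorem pos_of_natCast_eq_unit_mul_sq (f : K →+* ℝ) {d : ℕ} (hd : 0 < d) {u : (𝓞 K)ˣ}
    {x : 𝓞 K} (h : (d : 𝓞 K) = u * x ^ 2) : 0 < f (u : 𝓞 K) := by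
  have h' : (d : ℝ) = f (u : 𝓞 K) * f x ^ 2 := by
    simpa using congrArg (fun y : 𝓞 K ↦ f y) h
  have hd' : (0 : ℝ) < f (u : 𝓞 K) * f x ^ 2 := h' ▸ Nat.cast_pos.2 hd
  exact pos_of_mul_pos_left hd' (sq_nonneg _)

omit [NumberField K] in
theorem isSquare_natCast_of_isSquare_unit {d : ℕ} {u : (𝓞 K)ˣ} {x : 𝓞 K}
    (h : (d : 𝓞 K) = u * x ^ 2) (hu : IsSquare u) : IsSquare (d : K) := by
  obtain ⟨w, rfl⟩ := hu
  refine ⟨(w : 𝓞 K) * x, ?_⟩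
  have := congrArg (fun y : 𝓞 K ↦ (y : K)) h
  simp only [map_natCast, Units.val_mul, map_mul, map_pow] at this
  rw [this]
  ring

theorem isSquare_natCast_or_or_mul (hr : Squarefree r) (h1 : 1 < r)
    (hdeg : Module.finrank ℚ K = 2) (hα : α ^ 2 = (r : K)) {d e : ℕ} (hd : 0 < d) (he : 0 < e)
    (hd' : ∃ (u : (𝓞 K)ˣ) (x : 𝓞 K), (d : 𝓞 K) = u * x ^ 2)
    (he' : ∃ (u : (𝓞 K)ˣ) (x : 𝓞 K), (e : 𝓞 K) = u * x ^ 2) :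
    IsSquare (d : K) ∨ IsSquare (e : K) ∨ IsSquare ((d * e : ℕ) : K) := by
  obtain ⟨f, -, -⟩ := exists_real_embeddings hr h1 hdeg hα
  obtain ⟨u, x, hu⟩ := hd'
  obtain ⟨v, y, hv⟩ := he'
  have huv : ((d * e : ℕ) : 𝓞 K) = (u * v : (𝓞 K)ˣ) * (x * y) ^ 2 := by
    push_cast
    rw [hu, hv]
    ring
  exact (isSquare_or_isSquare_or_isSquare_mul hr h1 hdeg hα f
    (pos_of_natCast_eq_unit_mul_sq f hd hu) (pos_of_natCast_eq_unit_mul_sq f he hv)).imp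
    (isSquare_natCast_of_isSquare_unit hu)
    (Or.imp (isSquare_natCast_of_isSquare_unit hv) (isSquare_natCast_of_isSquare_unit huv))

omit [NumberField K] in
theorem exists_ringOfIntegers_sq_eq (hα : α ^ 2 = (r : K)) :
    ∃ a : 𝓞 K, (a : K) = α ∧ a ^ 2 = r := by
  have hint : IsIntegral ℤ α := IsIntegral.of_pow two_pos (by
    rw [hα]
    exact_mod_cast isIntegral_algebraMap (R := ℤ) (x := (r : ℤ)))
  obtain ⟨a, ha⟩ : ∃ a : 𝓞 K, (a : K) = α := ⟨⟨α, hint⟩, rfl⟩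
  exact ⟨a, ha, RingOfIntegers.ext (by simpa [ha] using hα)⟩

variable [IsPrincipalIdealRing (𝓞 K)]

omit [NumberField K] in
theorem exists_unit_mul_sq_of_mul_eq (hr : Squarefree r) (hα : α ^ 2 = (r : K)) {d m : ℕ}
    (h : d * m = r) : ∃ (u : (𝓞 K)ˣ) (x : 𝓞 K), (d : 𝓞 K) = u * x ^ 2 := by
  obtain ⟨a, -, ha⟩ := exists_ringOfIntegers_sq_eq hα
  have hco : d.Coprime m := Nat.coprime_of_squarefree_mul (h ▸ hr)
  exact (hco.cast (R := 𝓞 K)).exists_unit_mul_sq (by rw [ha, ← h, Nat.cast_mul])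

omit [NumberField K] in
theorem exists_two_eq_unit_mul_sq (hα : α ^ 2 = (r : K)) (h3 : r % 4 = 3) :
    ∃ (u : (𝓞 K)ˣ) (x : 𝓞 K), ((2 : ℕ) : 𝓞 K) = u * x ^ 2 := by
  obtain ⟨a, -, ha⟩ := exists_ringOfIntegers_sq_eq hα
  obtain ⟨k, rfl⟩ : ∃ k, r = 4 * k + 3 := ⟨r / 4, by omega⟩
  push_cast at ha ⊢
  have hco : IsCoprime (2 : 𝓞 K) (2 * k + 2 + a) :=
    ⟨-(2 * k ^ 2 + 2 * k), -(a - 2 * k - 2), by linear_combination -ha⟩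
  exact hco.exists_unit_mul_sq (c := 1 + a) (by linear_combination -ha)

theorem exists_unit_mul_neg (hr : Squarefree r) (hα : α ^ 2 = (r : K)) (f g : K →+* ℝ)
    (hfg : g α = -f α) (hr3 : ∀ p : ℕ, p.Prime → p ∣ r → p % 4 ≠ 3) :
    ∃ v : (𝓞 K)ˣ, f (v : 𝓞 K) * g (v : 𝓞 K) < 0 := by
  obtain ⟨x, y, hxy, hodd⟩ : ∃ x y : ℕ, r = x ^ 2 + y ^ 2 ∧ Odd y := by
    obtain ⟨x, y, hxy⟩ := Nat.eq_sq_add_sq_of_isSquare_mod_neg_one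
      ((ZMod.isSquare_neg_one_iff_forall_mem_primeFactors_mod_four_ne_three hr).2 fun q hq ↦
        hr3 q (Nat.prime_of_mem_primeFactors hq) (Nat.dvd_of_mem_primeFactors hq))
    by_cases hy : Odd y
    · exact ⟨x, y, hxy, hy⟩
    · refine ⟨y, x, by rw [hxy, add_comm], ?_⟩
      by_contra hx
      rw [Nat.not_odd_iff_even] at hx hy
      have := hr 2 (hxy ▸ dvd_add (by simpa [sq] using mul_dvd_mul hx.two_dvd hx.two_dvd)
        (by simpa [sq] using mul_dvd_mul hy.two_dvd hy.two_dvd))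
      simp at this
  have hcop : x.Coprime y := by
    refine Nat.isUnit_iff.1 (hr _ (hxy ▸ dvd_add ?_ ?_))
    · simpa [sq] using mul_dvd_mul (Nat.gcd_dvd_left x y) (Nat.gcd_dvd_left x y)
    · simpa [sq] using mul_dvd_mul (Nat.gcd_dvd_right x y) (Nat.gcd_dvd_right x y)
  obtain ⟨a, haα, ha⟩ := exists_ringOfIntegers_sq_eq hα
  have hprod : (a + x) * (a - x) = (y : 𝓞 K) ^ 2 := by
    rw [hxy] at ha
    push_cast at ha
    linear_combination ha
  have hco : IsCoprime (a + x : 𝓞 K) (a - x) := by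
    have h2 : (2 * x).Coprime (y ^ 2) :=
      (Nat.Coprime.mul_left (Nat.coprime_two_left.2 hodd) hcop).pow_right 2
    obtain ⟨s, t, hst⟩ := h2.cast (R := 𝓞 K)
    push_cast at hst
    exact ⟨s + t * (a - x), -s, by linear_combination hst + t * hprod⟩
  obtain ⟨v, z, hv⟩ := hco.exists_unit_mul_sq hprod
  refine ⟨v, ?_⟩
  have hf : f α + x = f (v : 𝓞 K) * f z ^ 2 := by
    simpa [haα] using congrArg (fun t : 𝓞 K ↦ f t) hv
  have hg : -f α + x = g (v : 𝓞 K) * g z ^ 2 := by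
    simpa [haα, hfg] using congrArg (fun t : 𝓞 K ↦ g t) hv
  have hfα : f α ^ 2 = r := by simp [← map_pow, hα]
  have hrR : (r : ℝ) = x ^ 2 + y ^ 2 := by exact_mod_cast hxy
  have hy : (0 : ℝ) < y ^ 2 := by
    have : (0 : ℝ) < y := Nat.cast_pos.2 hodd.pos
    positivity
  have key : f (v : 𝓞 K) * g (v : 𝓞 K) * (f z * g z) ^ 2 = -(y : ℝ) ^ 2 := by
    calc _ = (f (v : 𝓞 K) * f z ^ 2) * (g (v : 𝓞 K) * g z ^ 2) := by ring
      _ = _ := by rw [← hf, ← hg]; linear_combination -hfα - hrR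
  by_contra! h
  nlinarith [mul_nonneg h (sq_nonneg (f z * g z))]

theorem prime_of_forall_prime_mod_four_ne_three (hr : Squarefree r) (h1 : 1 < r)
    (hdeg : Module.finrank ℚ K = 2) (hα : α ^ 2 = (r : K))
    (hr3 : ∀ p : ℕ, p.Prime → p ∣ r → p % 4 ≠ 3) : r.Prime := by
  obtain ⟨f, g, hfg⟩ := exists_real_embeddings hr h1 hdeg hα
  obtain ⟨v, hv⟩ := exists_unit_mul_neg hr hα f g hfg hr3
  obtain ⟨p, hp, m, hpm⟩ := Nat.exists_prime_and_dvd h1.ne'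
  obtain ⟨u, x, hu⟩ := exists_unit_mul_sq_of_mul_eq hr hα hpm.symm
  have hsq := isSquare_natCast_of_isSquare_unit hu
    (isSquare_of_mul_neg hr h1 hdeg hα f g hv (pos_of_natCast_eq_unit_mul_sq f hp.pos hu)
      (pos_of_natCast_eq_unit_mul_sq g hp.pos hu))
  exact (eq_one_or_eq_of_isSquare hr h1 hdeg hα hp.prime.squarefree hsq).resolve_left
    hp.ne_one ▸ hp

theorem prime_or_eq_mul (hr : Squarefree r) (h1 : 1 < r) (hdeg : Module.finrank ℚ K = 2)
    (hα : α ^ 2 = (r : K)) :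
    r.Prime ∨ ∃ p q : ℕ, p.Prime ∧ q.Prime ∧ r = p * q ∧ p % 4 = 3 ∧ (q = 2 ∨ q % 4 = 3) := by
  by_cases hr3 : ∀ p : ℕ, p.Prime → p ∣ r → p % 4 ≠ 3
  · exact Or.inl (prime_of_forall_prime_mod_four_ne_three hr h1 hdeg hα hr3)
  push Not at hr3
  obtain ⟨p, hp, ⟨m, rfl⟩, hp3⟩ := hr3
  rw [or_iff_not_imp_left]
  intro hnp
  have hpr : p ≠ p * m := fun h ↦ hnp (h ▸ hp)
  have hm1 : m ≠ 1 := fun h ↦ hpr (by rw [h, mul_one])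
  obtain ⟨q, hq, n, rfl⟩ := Nat.exists_prime_and_dvd hm1
  have hp' := exists_unit_mul_sq_of_mul_eq hr hα rfl
  have hq' := exists_unit_mul_sq_of_mul_eq (d := q) (m := p * n) hr hα (by ring)
  have hpq : Squarefree (p * q) := hr.squarefree_of_dvd ⟨n, by ring⟩
  have hqr : q ≠ p * (q * n) := by
    intro h
    exact hp.ne_one (Nat.isUnit_iff.1 (isUnit_of_dvd_one
      ((Nat.mul_dvd_mul_iff_right hq.pos).1 ⟨n, by rw [one_mul]; linarith⟩)))
  have hsq {d : ℕ} (hd : Squarefree d) (hd1 : d ≠ 1) (h : IsSquare (d : K)) :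
      d = p * (q * n) :=
    (eq_one_or_eq_of_isSquare hr h1 hdeg hα hd h).resolve_left hd1
  have heq : p * q = p * (q * n) := by
    rcases isSquare_natCast_or_or_mul hr h1 hdeg hα hp.pos hq.pos hp' hq' with h | h | h
    · exact absurd (hsq hp.prime.squarefree hp.ne_one h) hpr
    · exact absurd (hsq hq.prime.squarefree hq.ne_one h) hqr
    · exact hsq hpq (fun h ↦ hp.ne_one (Nat.eq_one_of_mul_eq_one_right h)) h
  refine ⟨p, q, hp, hq, heq.symm, hp3, ?_⟩
  by_contra! hq3
  have hq1 : q % 4 = 1 := by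
    have := hq.eq_two_or_odd
    omega
  have hr3 : p * (q * n) % 4 = 3 := by rw [← heq, Nat.mul_mod, hp3, hq1]
  have h2 := exists_two_eq_unit_mul_sq hα hr3
  rcases isSquare_natCast_or_or_mul hr h1 hdeg hα hp.pos two_pos hp' h2 with h | h | h
  · exact hpr (hsq hp.prime.squarefree hp.ne_one h)
  · have := hsq Nat.prime_two.prime.squarefree (by norm_num) h
    omega
  · have hcop : p.Coprime 2 := by
      rw [Nat.coprime_two_right]
      exact Nat.odd_iff.2 (by omega)
    have := hsq ((Nat.squarefree_mul hcop).2
      ⟨hp.prime.squarefree, Nat.prime_two.prime.squarefree⟩) (by omega) h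
    omega

end RealQuadratic

/-- (Behrbohm–Rédei) If the real quadratic field `ℚ(√r)` (with `r > 1` square-free)
has class number 1, then either `r` is prime, or `r = p·q` with `p`, `q` primes,
`p ≡ 3 (mod 4)` and `q = 2` or `q ≡ 3 (mod 4)`. -/
theorem behrbohm_redei
    (r : ℤ) (hr : Squarefree r) (h1 : 1 < r)
    (K : Type*) [Field K] [NumberField K]
    (hdeg : Module.finrank ℚ K = 2)
    (α : K) (hα : α ^ 2 = (r : K))
    (hcl : NumberField.classNumber K = 1) :
    Prime r ∨
      ∃ p q : ℕ, p.Prime ∧ q.Prime ∧ r = (p : ℤ) * q ∧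
        p % 4 = 3 ∧ (q = 2 ∨ q % 4 = 3) := by
  have : IsPrincipalIdealRing (NumberField.RingOfIntegers K) :=
    NumberField.classNumber_eq_one_iff.1 hcl
  lift r to ℕ using by omega
  rcases RealQuadratic.prime_or_eq_mul (Int.squarefree_natCast.1 hr) (by exact_mod_cast h1) hdeg
    (by simpa using hα) with h | ⟨p, q, hp, hq, hpq, h⟩
  · exact Or.inl (Nat.prime_iff_prime_int.1 h)
  · exact Or.inr ⟨p, q, hp, hq, by exact_mod_cast hpq, h⟩
end

section
/- Let r be a positive square-free integer with r ≡ 2 (mod 8) and r ≠ 2, and let K = ℚ(√r). Then the ring of integers of K is not a unique factorization domain; equivalently, the class number of K is greater than 1. -/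
open NumberField

theorem exists_jacobiSym_eq_neg_one {m : ℕ} (hm : Squarefree m) (hodd : Odd m) (h1 : m ≠ 1) :
    ∃ a : ℕ, jacobiSym a m = -1 := by
  obtain ⟨p, hp, k, rfl⟩ := Nat.exists_prime_and_dvd h1
  have := Fact.mk hp
  have hpk : p.Coprime k := Nat.coprime_of_squarefree_mul hm
  have hp2 : p ≠ 2 := by
    rintro rfl
    exact (Nat.not_even_iff_odd.2 hodd) (even_two_mul k)
  have hk0 : k ≠ 0 := by
    rintro rfl
    simp at hodd
  obtain ⟨x, hx⟩ := FiniteField.exists_nonsquare (F := ZMod p) (by rwa [ZMod.ringChar_zmod_n])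
  obtain ⟨a, hap, hak⟩ := Nat.chineseRemainder hpk x.val 1
  refine ⟨a, ?_⟩
  rw [jacobiSym.mul_right' _ hp.ne_zero hk0]
  have hk : jacobiSym a k = 1 := by
    rw [jacobiSym.mod_left' (a₂ := 1) (by exact_mod_cast hak), jacobiSym.one_left]
  have hp : jacobiSym a p = -1 := by
    rw [ZMod.nonsquare_iff_jacobiSym_eq_neg_one]
    have := (ZMod.natCast_eq_natCast_iff _ _ _).2 hap
    rw [ZMod.natCast_zmod_val] at this
    simpa [this] using hx
  rw [hk, hp, mul_one]

theorem exists_prime_five_mod_eight_jacobiSym_eq_neg_one {m : ℕ} (hm : Squarefree m)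
    (hodd : Odd m) (h1 : m ≠ 1) :
    ∃ q : ℕ, q.Prime ∧ q % 8 = 5 ∧ jacobiSym q m = -1 := by
  obtain ⟨a, ha⟩ := exists_jacobiSym_eq_neg_one hm hodd h1
  have hcop : Nat.Coprime 8 m := (Nat.coprime_two_left.2 hodd).pow_left 3
  obtain ⟨c, hc8, hcm⟩ := Nat.chineseRemainder hcop 5 a
  have := NeZero.mk hm.ne_zero
  have ham : a.Coprime m := by
    by_contra h
    have := jacobiSym.eq_zero_iff_not_coprime (a := a) (b := m)
    simp [ha] at this
    exact h this
  have hc : c.Coprime (8 * m) := by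
    refine Nat.Coprime.mul_right ?_ ?_
    · exact (hc8.gcd_eq).trans (by norm_num)
    · exact (hcm.gcd_eq).trans ham
  obtain ⟨q, -, hq, hqc⟩ := Nat.forall_exists_prime_gt_and_eq_mod
    ((ZMod.isUnit_iff_coprime _ _).2 hc) 0
  rw [ZMod.natCast_eq_natCast_iff] at hqc
  refine ⟨q, hq, (hqc.of_mul_right m).trans hc8, ?_⟩
  rw [← ha]
  exact jacobiSym.mod_left' (by exact_mod_cast (hqc.of_mul_left 8).trans hcm)

theorem jacobiSym_ne_neg_one_of_four_mul_eq {m : ℕ} (hm : m % 4 = 1) {N T Y : ℤ}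
    (h : 4 * N = T ^ 2 - m * Y) : jacobiSym N.natAbs m ≠ -1 := by
  have hodd : Odd m := Nat.odd_iff.2 (by omega)
  have habs : jacobiSym N.natAbs m = jacobiSym N m := by
    rcases Int.natAbs_eq N with h' | h'
    · rw [← h']
    · conv_rhs => rw [h']
      rw [jacobiSym.neg _ hodd, ZMod.χ₄_nat_one_mod_four hm, one_mul]
  have h4 : jacobiSym N m = jacobiSym T m ^ 2 := by
    rw [← jacobiSym.pow_left, ← one_mul (jacobiSym N m), ← jacobiSym.at_four hodd,
      ← jacobiSym.mul_left, h]
    exact jacobiSym.mod_left' (by simp)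
  rw [habs, h4]
  nlinarith [sq_nonneg (jacobiSym T m)]

section Quadratic

variable {K : Type*} [Field K] [NumberField K]

theorem exists_basis_one_sqrt (hdeg : Module.finrank ℚ K = 2) {d : ℚ} (hd : ¬ IsSquare d)
    {α : K} (hα : α ^ 2 = algebraMap ℚ K d) :
    ∃ b : Module.Basis (Fin 2) ℚ K, b 0 = 1 ∧ b 1 = α := by
  have hli : LinearIndependent ℚ ![(1 : K), α] := by
    rw [LinearIndependent.pair_iff' one_ne_zero]
    rintro a rfl
    refine hd ⟨a, ?_⟩
    apply (algebraMap ℚ K).injective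
    rw [← hα, Algebra.smul_def, mul_one, map_mul, sq]
  refine ⟨basisOfLinearIndependentOfCardEqFinrank hli (by simp [hdeg]), ?_, ?_⟩ <;> simp

theorem leftMulMatrix_basis_one_sqrt {d : ℚ} {α : K} (hα : α ^ 2 = algebraMap ℚ K d)
    (b : Module.Basis (Fin 2) ℚ K) (h0 : b 0 = 1) (h1 : b 1 = α) (x y : ℚ) :
    Algebra.leftMulMatrix b (algebraMap ℚ K x + algebraMap ℚ K y * α) = !![x, d * y; y, x] := by
  have e0 : (algebraMap ℚ K x + algebraMap ℚ K y * α) * b 0 = x • b 0 + y • b 1 := by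
    simp only [h0, h1, Algebra.smul_def, mul_one]
  have e1 : (algebraMap ℚ K x + algebraMap ℚ K y * α) * b 1 = (d * y) • b 0 + x • b 1 := by
    simp only [h0, h1, Algebra.smul_def, mul_one, map_mul, ← hα]
    ring
  ext i j
  rw [Algebra.leftMulMatrix_eq_repr_mul]
  fin_cases j
  · simp only [Fin.zero_eta, e0]
    fin_cases i <;> simp
  · simp only [Fin.mk_one, e1]
    fin_cases i <;> simp

theorem trace_add_mul_sqrt (hdeg : Module.finrank ℚ K = 2) {d : ℚ} (hd : ¬ IsSquare d)
    {α : K} (hα : α ^ 2 = algebraMap ℚ K d) (x y : ℚ) :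
    Algebra.trace ℚ K (algebraMap ℚ K x + algebraMap ℚ K y * α) = 2 * x := by
  obtain ⟨b, h0, h1⟩ := exists_basis_one_sqrt hdeg hd hα
  rw [Algebra.trace_eq_matrix_trace b, leftMulMatrix_basis_one_sqrt hα b h0 h1,
    Matrix.trace_fin_two_of, two_mul]

theorem norm_add_mul_sqrt (hdeg : Module.finrank ℚ K = 2) {d : ℚ} (hd : ¬ IsSquare d)
    {α : K} (hα : α ^ 2 = algebraMap ℚ K d) (x y : ℚ) :
    Algebra.norm ℚ (algebraMap ℚ K x + algebraMap ℚ K y * α) = x ^ 2 - d * y ^ 2 := by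
  obtain ⟨b, h0, h1⟩ := exists_basis_one_sqrt hdeg hd hα
  rw [Algebra.norm_eq_matrix_det b, leftMulMatrix_basis_one_sqrt hα b h0 h1,
    Matrix.det_fin_two_of]
  ring

theorem exists_eq_add_mul_sqrt (hdeg : Module.finrank ℚ K = 2) {d : ℚ} (hd : ¬ IsSquare d)
    {α : K} (hα : α ^ 2 = algebraMap ℚ K d) (u : K) :
    ∃ x y : ℚ, u = algebraMap ℚ K x + algebraMap ℚ K y * α := by
  obtain ⟨b, h0, h1⟩ := exists_basis_one_sqrt hdeg hd hα
  refine ⟨b.repr u 0, b.repr u 1, ?_⟩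
  conv_lhs => rw [← b.sum_repr u]
  simp only [Fin.sum_univ_two, h0, h1, Algebra.smul_def, mul_one]

theorem exists_four_mul_norm_eq (hdeg : Module.finrank ℚ K = 2) {r : ℤ} (hr : Squarefree r)
    (hsq : ¬ IsSquare (r : ℚ)) {a : 𝓞 K} (ha : a ^ 2 = (r : 𝓞 K)) (u : 𝓞 K) :
    ∃ T Y : ℤ, 4 * Algebra.norm ℤ u = T ^ 2 - r * Y ^ 2 := by
  have hα : (a : K) ^ 2 = algebraMap ℚ K r := by
    simpa using congrArg (algebraMap (𝓞 K) K) ha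
  obtain ⟨x, y, hu⟩ := exists_eq_add_mul_sqrt hdeg hsq hα (u : K)
  have hT : (Algebra.trace ℤ _ u : ℚ) = 2 * x := by
    rw [Algebra.coe_trace_int, hu, trace_add_mul_sqrt hdeg hsq hα]
  have hN : (Algebra.norm ℤ u : ℚ) = x ^ 2 - r * y ^ 2 := by
    rw [Algebra.coe_norm_int, hu, norm_add_mul_sqrt hdeg hsq hα]
  have hZ : (Algebra.trace ℤ _ (u * a) : ℚ) = 2 * (r * y) := by
    have : ((u * a : 𝓞 K) : K) = algebraMap ℚ K (r * y) + algebraMap ℚ K x * (a : K) := by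
      rw [show ((u * a : 𝓞 K) : K) = u * a from map_mul _ u a, hu, map_mul, ← hα]
      ring
    rw [Algebra.coe_trace_int, this, trace_add_mul_sqrt hdeg hsq hα]
  have key : 4 * Algebra.norm ℤ u * r =
      r * Algebra.trace ℤ _ u ^ 2 - Algebra.trace ℤ _ (u * a) ^ 2 := by
    have : (4 * Algebra.norm ℤ u * r : ℚ) =
        r * (Algebra.trace ℤ _ u : ℚ) ^ 2 - (Algebra.trace ℤ _ (u * a) : ℚ) ^ 2 := by
      rw [hT, hN, hZ]
      ring
    exact_mod_cast this
  obtain ⟨Y, hY⟩ : r ∣ Algebra.trace ℤ _ (u * a) := by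
    rw [← hr.dvd_pow_iff_dvd two_ne_zero]
    exact ⟨Algebra.trace ℤ _ u ^ 2 - 4 * Algebra.norm ℤ u, by linear_combination key⟩
  refine ⟨Algebra.trace ℤ _ u, Y, mul_right_cancel₀ hr.ne_zero ?_⟩
  rw [key, hY]
  ring

/-- If `K = ℚ(√r)` has class number one and the odd prime `q` splits in `K`,
then `q` is, up to sign, the norm of an integer of `K`. -/
theorem exists_natAbs_norm_eq_of_isPrincipalIdealRing [IsPrincipalIdealRing (𝓞 K)]
    (hdeg : Module.finrank ℚ K = 2) {r : ℤ}
    (hsq : ¬ IsSquare (r : ℚ)) {a : 𝓞 K} (ha : a ^ 2 = (r : 𝓞 K)) {q : ℕ} (hq : q.Prime)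
    (hq2 : q ≠ 2) (hqr : ¬ (q : ℤ) ∣ r) {s : ℤ} (hs : (q : ℤ) ∣ s ^ 2 - r) :
    ∃ u : 𝓞 K, (Algebra.norm ℤ u).natAbs = q := by
  have hα : (a : K) ^ 2 = algebraMap ℚ K r := by
    simpa using congrArg (algebraMap (𝓞 K) K) ha
  have hqp : Prime (q : ℤ) := Nat.prime_iff_prime_int.1 hq
  have hnormq : Algebra.norm ℤ (q : 𝓞 K) = (q : ℤ) ^ 2 := by
    have := Algebra.norm_algebraMap (S := 𝓞 K) (q : ℤ)
    rw [RingOfIntegers.rank, hdeg] at this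
    simpa using this
  have hqs : ¬ (q : ℤ) ∣ s := fun h => hqr <| by
    simpa using dvd_sub (dvd_pow h two_ne_zero) hs
  have hndvd : ∀ e : ℤ, ¬ (q : 𝓞 K) ∣ s + e * a := by
    rintro e ⟨w, hw⟩
    obtain ⟨x, y, hxy⟩ := exists_eq_add_mul_sqrt hdeg hsq hα (w : K)
    have h1 : algebraMap ℚ K s + algebraMap ℚ K e * (a : K) =
        algebraMap ℚ K (q * x) + algebraMap ℚ K (q * y) * (a : K) := by
      have := congrArg (algebraMap (𝓞 K) K) hw
      simp only [map_add, map_mul, map_intCast, map_natCast] at this ⊢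
      rw [this, show algebraMap (𝓞 K) K w = _ from hxy]
      ring
    have h2 := congrArg (Algebra.trace ℚ K) h1
    rw [trace_add_mul_sqrt hdeg hsq hα, trace_add_mul_sqrt hdeg hsq hα] at h2
    have hT : (Algebra.trace ℤ _ w : ℚ) = 2 * x := by
      rw [Algebra.coe_trace_int, hxy, trace_add_mul_sqrt hdeg hsq hα]
    have h3 : 2 * s = q * Algebra.trace ℤ _ w := by
      have : (2 * s : ℚ) = q * (Algebra.trace ℤ _ w : ℚ) := by
        rw [h2, hT]
        ring
      exact_mod_cast this
    rcases hqp.dvd_or_dvd (Dvd.intro _ h3.symm) with h | h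
    · exact hq2 ((Nat.prime_dvd_prime_iff_eq hq Nat.prime_two).1 (by exact_mod_cast h))
    · exact hqs h
  have hnp : ¬ Prime (q : 𝓞 K) := by
    intro hp
    obtain ⟨t, ht⟩ := hs
    have : (q : 𝓞 K) ∣ (s + (1 : ℤ) * a) * (s + (-1 : ℤ) * a) := by
      refine ⟨t, ?_⟩
      have := congrArg (Int.cast : ℤ → 𝓞 K) ht
      push_cast at this ⊢
      rw [← this, ← ha]
      ring
    rcases hp.dvd_or_dvd this with h | h <;> exact hndvd _ h
  have hunit : ∀ v : 𝓞 K, IsUnit v ↔ (Algebra.norm ℤ v).natAbs = 1 := by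
    intro v
    rw [NumberField.isUnit_iff_norm, RingOfIntegers.coe_norm, ← Algebra.coe_norm_int, ← Int.cast_abs,
      Int.cast_eq_one, Int.abs_eq_natAbs, Nat.cast_eq_one]
  have hnu : ¬ IsUnit (q : 𝓞 K) := by
    rw [hunit, hnormq, Int.natAbs_pow, Int.natAbs_natCast]
    exact fun h => hq.ne_one (Nat.pow_eq_one.1 h |>.resolve_right two_ne_zero)
  rw [← irreducible_iff_prime, irreducible_iff] at hnp
  push Not at hnp
  obtain ⟨u, v, huv, hu, hv⟩ := hnp hnu
  refine ⟨u, ?_⟩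
  rw [hunit] at hu hv
  have hmul : (Algebra.norm ℤ u).natAbs * (Algebra.norm ℤ v).natAbs = q ^ 2 := by
    rw [← Int.natAbs_mul, ← map_mul, ← huv, hnormq, Int.natAbs_pow, Int.natAbs_natCast]
  exact ((hq.mul_eq_prime_sq_iff hu hv).1 hmul).1

end Quadratic

/-- For a positive square-free `r ≡ 2 (mod 8)` with `r ≠ 2`, the real quadratic
field `ℚ(√r)` has class number greater than 1 (its ring of integers is not a UFD). -/
theorem classNumber_gt_one_of_two_mod_eight
    (r : ℤ) (hr : Squarefree r) (hpos : 0 < r) (h8 : r % 8 = 2) (h2 : r ≠ 2)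
    (K : Type*) [Field K] [NumberField K]
    (hdeg : Module.finrank ℚ K = 2)
    (α : K) (hα : α ^ 2 = (r : K)) :
    1 < NumberField.classNumber K := by
  have hne : NumberField.classNumber K ≠ 0 := Fintype.card_ne_zero
  by_contra hlt
  have hpid := classNumber_eq_one_iff.1 (show NumberField.classNumber K = 1 by omega)
  have hsq : ¬ IsSquare (r : ℚ) := by
    rw [Rat.isSquare_intCast_iff]
    rintro ⟨c, hc⟩
    rcases Int.even_or_odd' c with ⟨k, rfl | rfl⟩ <;> ring_nf at hc <;> omega
  obtain ⟨m, rfl⟩ : ∃ m : ℕ, r = 2 * m := ⟨(r / 2).toNat, by omega⟩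
  have hm4 : m % 4 = 1 := by omega
  have hodd : Odd m := Nat.odd_iff.2 (by omega)
  have hm : Squarefree m := Int.squarefree_natCast.1 (hr.of_mul_right)
  obtain ⟨q, hq, hq8, hqm⟩ := exists_prime_five_mod_eight_jacobiSym_eq_neg_one hm hodd (by omega)
  have := Fact.mk hq
  have hqodd : Odd q := Nat.odd_iff.2 (by omega)
  have hJ : jacobiSym (2 * m) q = 1 := by
    rw [jacobiSym.mul_left, jacobiSym.quadratic_reciprocity_one_mod_four hm4 hqodd, hqm,
      jacobiSym.at_two hqodd, ZMod.χ₈_nat_eq_if_mod_eight]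
    simp [hq8, Nat.odd_iff.1 hqodd]
  obtain ⟨z, hz⟩ := ZMod.isSquare_of_jacobiSym_eq_one hJ
  obtain ⟨s, rfl⟩ := ZMod.intCast_surjective z
  have hs : (q : ℤ) ∣ s ^ 2 - 2 * m := by
    rw [← ZMod.intCast_zmod_eq_zero_iff_dvd, Int.cast_sub, hz]
    push_cast
    ring
  have hqr : ¬ (q : ℤ) ∣ 2 * m := by
    intro h
    rw [jacobiSym.mod_left, Int.emod_eq_zero_of_dvd h, jacobiSym.zero_left hq.one_lt] at hJ
    exact zero_ne_one hJ
  let a : 𝓞 K := ⟨α, .of_pow two_pos (by rw [hα]; exact isIntegral_algebraMap (R := ℤ))⟩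
  have ha : a ^ 2 = ((2 * m : ℤ) : 𝓞 K) := by
    apply FaithfulSMul.algebraMap_injective (𝓞 K) K
    rw [map_pow, map_intCast]
    exact hα
  obtain ⟨u, hu⟩ := exists_natAbs_norm_eq_of_isPrincipalIdealRing hdeg hsq ha hq (by omega) hqr hs
  obtain ⟨T, Y, h⟩ := exists_four_mul_norm_eq hdeg hr hsq ha u
  refine jacobiSym_ne_neg_one_of_four_mul_eq hm4 (N := Algebra.norm ℤ u) (T := T)
    (Y := 2 * Y ^ 2) (by rw [h]; ring) ?_
  rw [hu, hqm]
end

section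
/- (Correctness of the sieve, odd case) Let d be an odd square-free integer with |d| > 1 (a discriminant ≡ 1 mod 4) and let N ≥ 2. Define S to be the set of odd natural numbers n with 3 ≤ n ≤ N such that either n is a prime dividing d, or the Jacobi symbol (d/n) equals 1. Then an element n of S is NOT a product of two elements of S if and only if one of the following holds: (1) n is a prime p with p ∣ d or (d/p) = 1; (2) n = p² for a prime p with (d/p) = -1; (3) n = p·q for distinct primes p, q with (d/p) = (d/q) = -1. -/
/-- A product of two primes has no factorization into nontrivial factors that both differ from
the first prime. -/
theorem Nat.Prime.eq_left_or_eq_left_of_mul_eq_mul {p q s t : ℕ} (hp : p.Prime) (hq : q.Prime)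
    (hs : s ≠ 1) (ht : t ≠ 1) (h : p * q = s * t) : s = p ∨ t = p := by
  rcases (hp.dvd_mul).1 (h ▸ dvd_mul_right p q) with ⟨c, rfl⟩ | ⟨c, rfl⟩
  · rw [mul_assoc] at h
    have hc := Nat.eq_of_mul_eq_mul_left hp.pos h
    rcases Nat.prime_mul_iff.1 (hc ▸ hq) with ⟨_, h1⟩ | ⟨_, h1⟩
    · exact absurd h1 ht
    · simp [h1]
  · rw [mul_left_comm] at h
    have hc := Nat.eq_of_mul_eq_mul_left hp.pos h
    rcases Nat.prime_mul_iff.1 (hc ▸ hq) with ⟨_, h1⟩ | ⟨_, h1⟩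
    · simp [h1]
    · exact absurd h1 hs

/-- The Jacobi symbol vanishes when the lower argument is a prime dividing the upper one. -/
theorem jacobiSym_eq_zero_of_prime_of_dvd {d : ℤ} {p : ℕ} (hp : p.Prime) (h : (p : ℤ) ∣ d) :
    jacobiSym d p = 0 := by
  refine jacobiSym.eq_zero_iff.2 ⟨hp.ne_zero, fun hg => hp.not_dvd_one ?_⟩
  exact hg ▸ Nat.dvd_gcd (Int.natCast_dvd.1 h) dvd_rfl

/-- Correctness of the sieve algorithm (odd case). Let `d` be an odd square-free
integer with `|d| > 1` and `N ≥ 2`. Let `S` be the set of odd naturals `n` with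
`3 ≤ n ≤ N` such that `n` is a prime dividing `d`, or the Jacobi symbol `(d/n)`
equals `1`. Then `n ∈ S` is not a product of two elements of `S` iff
(1) `n` is a prime `p` with `p ∣ d` or `(d/p) = 1`; or
(2) `n = p²` for a prime `p` with `(d/p) = -1`; or
(3) `n = p·q` for distinct primes `p`, `q` with `(d/p) = (d/q) = -1`. -/
theorem sieve_correctness_odd
    (d : ℤ) (hodd : Odd d) (hsf : Squarefree d) (hd1 : 1 < d.natAbs)
    (N : ℕ) (hN : 2 ≤ N)
    (S : Set ℕ)
    (hS : S = {n : ℕ | 3 ≤ n ∧ n ≤ N ∧ Odd n ∧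
      ((n.Prime ∧ (n : ℤ) ∣ d) ∨ jacobiSym d n = 1)}) :
    ∀ n ∈ S,
      (¬ ∃ s ∈ S, ∃ t ∈ S, n = s * t) ↔
        ((n.Prime ∧ ((n : ℤ) ∣ d ∨ jacobiSym d n = 1)) ∨
         (∃ p : ℕ, p.Prime ∧ n = p ^ 2 ∧ jacobiSym d p = -1) ∨
         (∃ p q : ℕ, p.Prime ∧ q.Prime ∧ p ≠ q ∧ n = p * q ∧
            jacobiSym d p = -1 ∧ jacobiSym d q = -1)) := by
  subst hS
  rintro n ⟨hn3, hnN, hn_odd, hn⟩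
  have three_le : ∀ {m : ℕ}, Odd m → m ≠ 1 → 3 ≤ m := by
    rintro m ⟨k, rfl⟩ h
    lia
  constructor
  · intro hprod
    by_cases hpr : n.Prime
    · exact .inl ⟨hpr, hn.imp_left And.right⟩
    replace hn : jacobiSym d n = 1 := hn.resolve_left fun h => hpr h.1
    have hJ : ∀ a b : ℕ, n = a * b → a ≠ 1 → b ≠ 1 → jacobiSym d a ≠ 1 := by
      intro a b hab ha hb h
      obtain ⟨hao, hbo⟩ := Nat.odd_mul.1 (hab ▸ hn_odd)
      rw [hab, jacobiSym.mul_right' d hao.pos.ne' hbo.pos.ne', h, one_mul] at hn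
      exact hprod ⟨a, ⟨three_le hao ha, (Nat.le_of_dvd (by lia) ⟨b, hab⟩).trans hnN, hao, .inr h⟩,
        b, ⟨three_le hbo hb, (Nat.le_of_dvd (by lia) ⟨a, hab.trans (mul_comm a b)⟩).trans hnN,
          hbo, .inr hn⟩, hab⟩
    obtain ⟨p, hp, m, rfl⟩ := Nat.exists_prime_and_dvd (show n ≠ 1 by lia)
    have hm1 : m ≠ 1 := by
      rintro rfl
      exact hpr (by simpa using hp)
    obtain ⟨q, hq, k, rfl⟩ := Nat.exists_prime_and_dvd hm1
    have hk0 : k ≠ 0 := by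
      rintro rfl
      simp at hn3
    rw [jacobiSym.mul_right' d hp.ne_zero (mul_ne_zero hq.ne_zero hk0),
      jacobiSym.mul_right' d hq.ne_zero hk0] at hn
    have hdp : jacobiSym d p = -1 := by
      have h1 := hJ p (q * k) rfl hp.ne_one hm1
      rcases jacobiSym.trichotomy d p with h | h | h
      · simp [h] at hn
      · exact absurd h h1
      · exact h
    have hdq : jacobiSym d q = -1 := by
      have h1 := hJ q (p * k) (by ring) hq.ne_one (by simp [hp.ne_one])
      rcases jacobiSym.trichotomy d q with h | h | h
      · simp [h] at hn
      · exact absurd h h1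
      · exact h
    obtain rfl : k = 1 := by
      by_contra hk
      refine hJ (p * q) k (by ring) (by simp [hp.ne_one]) hk ?_
      rw [jacobiSym.mul_right' d hp.ne_zero hq.ne_zero, hdp, hdq]
      norm_num
    by_cases hpq : p = q
    · subst hpq
      exact .inr (.inl ⟨p, hp, by ring, hdp⟩)
    · exact .inr (.inr ⟨p, q, hp, hq, hpq, by ring, hdp, hdq⟩)
  · rintro h ⟨s, ⟨hs3, -, -, hs⟩, t, ⟨ht3, -, -, ht⟩, rfl⟩
    have key : ∀ p q : ℕ, p.Prime → q.Prime → jacobiSym d p = -1 → s * t ≠ p * q := by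
      intro p q hp hq hdp hst
      have hpS : ¬ ((p.Prime ∧ (p : ℤ) ∣ d) ∨ jacobiSym d p = 1) := by
        rintro (⟨-, h⟩ | h)
        · simp [jacobiSym_eq_zero_of_prime_of_dvd hp h] at hdp
        · simp [h] at hdp
      rcases hp.eq_left_or_eq_left_of_mul_eq_mul hq (by lia) (by lia) hst.symm with rfl | rfl
      · exact hpS hs
      · exact hpS ht
    rcases h with ⟨hpr, -⟩ | ⟨p, hp, hst, hdp⟩ | ⟨p, q, hp, hq, -, hst, hdp, -⟩
    · exact Nat.not_prime_mul (by lia) (by lia) hpr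
    · exact key p p hp hp hdp (hst.trans (sq p))
    · exact key p q hp hq hdp hst
end
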